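/- Let x ∈ JT be a positive, separated vector and let a ∈ supp(x) be a node that is not maximal in supp(x) (i.e. a has a strict descendant in supp(x)). Let c₀ and c₁ be the two children of a in T. Then W_{c₀} ∩ supp(x) ≠ ∅ and W_{c₁} ∩ supp(x) ≠ ∅, and S_{c₀}(x) = S_{c₁}(x). -/

import Mathlib

/-! Common framework for the James Tree space `JT`.

The dyadic tree is modelled as `List Bool`, ordered by `List.IsPrefix` (`<+:`). -/

abbrev DyadicNode := List Bool

namespace JTSpace

/-- A segment of the dyadic tree: a linearly ordered, order-convex subset. -/
def IsSegment (S : Set DyadicNode) : Prop :=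
  (∀ a ∈ S, ∀ b ∈ S, a <+: b ∨ b <+: a) ∧
  (∀ a ∈ S, ∀ b ∈ S, ∀ c : DyadicNode, a <+: c → c <+: b → c ∈ S)

/-- A partition: a family of pairwise disjoint segments. -/
def IsPartition (P : Set (Set DyadicNode)) : Prop :=
  (∀ S ∈ P, IsSegment S) ∧ P.PairwiseDisjoint id

/-- The sum of `x` along a set of nodes. -/
noncomputable def segSum (x : DyadicNode → ℝ) (S : Set DyadicNode) : ℝ :=
  ∑' a : S, x a

/-- The square of the value `‖x‖_P` of `x` on the partition `P`. -/
noncomputable def pNormSq (x : DyadicNode → ℝ) (P : Set (Set DyadicNode)) : ℝ :=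
  ∑' S : P, (segSum x S) ^ 2

/-- The set of all values `‖x‖_P²` over partitions `P`. -/
def normSqSet (x : DyadicNode → ℝ) : Set ℝ :=
  {r | ∃ P, IsPartition P ∧ r = pNormSq x P}

/-- The square of the `JT` norm. -/
noncomputable def JTnormSq (x : DyadicNode → ℝ) : ℝ := sSup (normSqSet x)

/-- The `JT` norm of `x`. -/
noncomputable def JTnorm (x : DyadicNode → ℝ) : ℝ := Real.sqrt (JTnormSq x)

/-- The `ℓ₂` norm of `x`. -/
noncomputable def l2norm (x : DyadicNode → ℝ) : ℝ := Real.sqrt (∑' a, (x a) ^ 2)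

def HasBddNorm (x : DyadicNode → ℝ) : Prop := BddAbove (normSqSet x)

/-- `x` belongs to the James Tree space: its norm is finite and it is approximable in the
`JT` norm by finitely supported functions (`JT` is the completion of `c₀₀(T)`). -/
def MemJT (x : DyadicNode → ℝ) : Prop :=
  HasBddNorm x ∧
  ∀ ε > (0 : ℝ), ∃ y : DyadicNode → ℝ, (Function.support y).Finite ∧
    HasBddNorm (x - y) ∧ JTnorm (x - y) ≤ ε

/-- An `x`-norming partition. -/
def IsNormingPartition (x : DyadicNode → ℝ) (P : Set (Set DyadicNode)) : Prop :=
  IsPartition P ∧ pNormSq x P = JTnormSq x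

/-- A complete subtree of the dyadic tree. -/
def IsCompleteSubtree (K : Set DyadicNode) : Prop :=
  ∀ a ∈ K, ∀ b ∈ K, ∀ c : DyadicNode, a <+: c → c <+: b → c ∈ K

/-- The range of `x`: the smallest complete subtree containing the support of `x`. -/
def ran (x : DyadicNode → ℝ) : Set DyadicNode :=
  ⋂₀ {K | IsCompleteSubtree K ∧ Function.support x ⊆ K}

/-- `x` is separated: every two distinct nodes of `ran x` are separated by some
`x`-norming partition. -/
def Separated (x : DyadicNode → ℝ) : Prop :=
  ∀ a ∈ ran x, ∀ b ∈ ran x, a ≠ b →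
    ∃ P, IsNormingPartition x P ∧ ∃ S ∈ P, ∃ S' ∈ P, S ≠ S' ∧ a ∈ S ∧ b ∈ S'

/-- `x` is an extreme point of the ball of radius `‖x‖_{JT}`. -/
def IsExtremePoint (x : DyadicNode → ℝ) : Prop :=
  x ≠ 0 ∧
  ∀ y z : DyadicNode → ℝ, MemJT y → MemJT z →
    ∀ l : ℝ, 0 < l → l < 1 → x = l • y + (1 - l) • z →
      JTnorm y = JTnorm x → JTnorm z = JTnorm x → y = x ∧ z = x

/-- A branch: a maximal segment. -/
def IsBranch (b : Set DyadicNode) : Prop :=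
  IsSegment b ∧ ∀ S : Set DyadicNode, IsSegment S → b ⊆ S → S = b

/-- The wedge rooted at `a`. -/
def wedge (a : DyadicNode) : Set DyadicNode := {b | a <+: b}

/-- The two children of a node. -/
def children (u : DyadicNode) : Set DyadicNode := {u ++ [false], u ++ [true]}

/-- The maximal segment sum starting at `a`:
`S_a(x) = sup { S_s(x) : s a segment with min s = a }`. -/
noncomputable def maxSum (x : DyadicNode → ℝ) (a : DyadicNode) : ℝ :=
  sSup {r | ∃ s : Set DyadicNode, IsSegment s ∧ a ∈ s ∧ (∀ b ∈ s, a <+: b) ∧ r = segSum x s}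

/-- The children of `u` within the subtree spanned by the support of `x`. -/
def supportedChildren (x : DyadicNode → ℝ) (u : DyadicNode) : Set DyadicNode :=
  {c ∈ children u | ∃ b ∈ Function.support x, c <+: b}

/-- A greedy partition for a positive vector `x`: a partition whose segments cover the
support of `x` and such that every segment, at every support node `u` which has a strict
descendant in the support, continues through a child of `u` (within the subtree spanned by
the support) maximizing the maximal segment sum, down to the next element of the support;
at support nodes with no strict descendant in the support, the segment's support ends. -/
def IsGreedyPartition (x : DyadicNode → ℝ) (P : Set (Set DyadicNode)) : Prop :=
  IsPartition P ∧ Function.support x ⊆ ⋃₀ P ∧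
  ∀ s ∈ P, ∀ u ∈ s ∩ Function.support x,
    ((∃ w ∈ Function.support x, u <+: w ∧ u ≠ w) →
      ∃ v ∈ s ∩ Function.support x, u <+: v ∧ u ≠ v ∧
        (∀ w ∈ s ∩ Function.support x, u <+: w → u ≠ w → v <+: w) ∧
        ∃ c ∈ supportedChildren x u, c <+: v ∧
          ∀ k ∈ supportedChildren x u, maxSum x k ≤ maxSum x c) ∧
    ((¬ ∃ w ∈ Function.support x, u <+: w ∧ u ≠ w) →
      ∀ w ∈ s ∩ Function.support x, w <+: u)



/-! ### Helper lemmas -/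

theorem segSum_eq (x : DyadicNode → ℝ) (S : Set DyadicNode) :
    segSum x S = ∑' n, S.indicator x n := by
  unfold segSum
  exact tsum_subtype S x

/-- Summability of `x` along `S`. -/
def SummOn (x : DyadicNode → ℝ) (S : Set DyadicNode) : Prop := Summable (S.indicator x)

theorem SummOn.mono {x : DyadicNode → ℝ} (hpos : ∀ a, 0 ≤ x a) {S S' : Set DyadicNode}
    (h : SummOn x S') (hs : S ⊆ S') : SummOn x S :=
  Summable.of_nonneg_of_le (fun n => Set.indicator_nonneg (fun a _ => hpos a) n)
    (fun n => Set.indicator_le_indicator_of_subset hs (fun a => hpos a) n) h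

theorem segSum_mono {x : DyadicNode → ℝ} (hpos : ∀ a, 0 ≤ x a) {S S' : Set DyadicNode}
    (h : SummOn x S') (hs : S ⊆ S') : segSum x S ≤ segSum x S' := by
  rw [segSum_eq, segSum_eq]
  exact Summable.tsum_le_tsum
    (fun n => Set.indicator_le_indicator_of_subset hs (fun a => hpos a) n) (h.mono hpos hs) h

theorem segSum_nonneg {x : DyadicNode → ℝ} (hpos : ∀ a, 0 ≤ x a) (S : Set DyadicNode) :
    0 ≤ segSum x S := tsum_nonneg (fun a => hpos a)

theorem segSum_union {x : DyadicNode → ℝ} {S S' : Set DyadicNode}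
    (h : SummOn x S) (h' : SummOn x S') (hd : Disjoint S S') :
    segSum x (S ∪ S') = segSum x S + segSum x S' := by
  rw [segSum_eq, segSum_eq, segSum_eq, ← Summable.tsum_add h h']
  congr 1
  exact Set.indicator_union_of_disjoint hd x

theorem segSum_singleton (x : DyadicNode → ℝ) (p : DyadicNode) : segSum x {p} = x p := by
  unfold segSum
  exact tsum_singleton p x

theorem segSum_empty (x : DyadicNode → ℝ) : segSum x ∅ = 0 := by
  rw [segSum_eq]; simp

theorem summOn_finite (x : DyadicNode → ℝ) {S : Set DyadicNode} (h : S.Finite) : SummOn x S :=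
  summable_of_finite_support (h.subset (by simp [Set.support_indicator]))

/-- The interval between two nodes. -/
def ivl (c m : DyadicNode) : Set DyadicNode := {p | c <+: p ∧ p <+: m}

theorem ivl_finite (c m : DyadicNode) : (ivl c m).Finite := by
  refine (List.finite_toSet m.inits).subset ?_
  intro p hp
  simpa using hp.2

theorem ivl_seg (c m : DyadicNode) : IsSegment (ivl c m) :=
  ⟨fun _ hp _ hq => List.prefix_or_prefix_of_prefix hp.2 hq.2,
   fun _ hp _ hq _ h1 h2 => ⟨hp.1.trans h1, h2.trans hq.2⟩⟩

/-- Finite disjoint families of segments give values below the norm. -/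
theorem family_le {x : DyadicNode → ℝ} (hb : HasBddNorm x) {ι : Type*} (F : Finset ι)
    (f : ι → Set DyadicNode) (hseg : ∀ i ∈ F, IsSegment (f i))
    (hd : ∀ i ∈ F, ∀ j ∈ F, i ≠ j → Disjoint (f i) (f j)) :
    ∑ i ∈ F, (segSum x (f i)) ^ 2 ≤ JTnormSq x := by
  classical
  have h1 : ∑ S ∈ F.image f, (segSum x S) ^ 2 = ∑ i ∈ F, (segSum x (f i)) ^ 2 := by
    apply Finset.sum_image_of_pairwise_eq_zero
    intro i hi j hj hij hfij
    have := hd i hi j hj hij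
    rw [← hfij, disjoint_self] at this
    have h0 : f i = ∅ := this
    rw [h0, segSum_empty]; simp
  rw [← h1]
  apply le_csSup hb
  refine ⟨(F.image f : Finset (Set DyadicNode)), ⟨?_, ?_⟩, ?_⟩
  · intro S hS
    simp only [Finset.coe_image, Set.mem_image, Finset.mem_coe] at hS
    obtain ⟨i, hi, rfl⟩ := hS
    exact hseg i hi
  · intro S hS S' hS' hne
    simp only [Finset.coe_image, Set.mem_image, Finset.mem_coe] at hS hS'
    obtain ⟨i, hi, rfl⟩ := hS
    obtain ⟨j, hj, rfl⟩ := hS'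
    exact hd i hi j hj (fun h => hne (by rw [h]))
  · unfold pNormSq
    exact (Finset.tsum_subtype (F.image f) (fun S => (segSum x S) ^ 2)).symm

theorem segSum_sq_le {x : DyadicNode → ℝ} (hb : HasBddNorm x) {S : Set DyadicNode}
    (hS : IsSegment S) : (segSum x S) ^ 2 ≤ JTnormSq x := by
  have := family_le hb (Finset.univ : Finset Unit) (fun _ => S) (fun _ _ => hS)
    (fun i _ j _ h => absurd rfl h)
  simpa using this

theorem segSum_le {x : DyadicNode → ℝ} (hb : HasBddNorm x) {S : Set DyadicNode}
    (hS : IsSegment S) : segSum x S ≤ JTnormSq x + 1 := by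
  nlinarith [segSum_sq_le hb hS, sq_nonneg (segSum x S - 1)]

theorem exists_top {S : Set DyadicNode} (hS : IsSegment S) (u : Finset DyadicNode)
    (hu : ∀ p ∈ u, p ∈ S) (hne : u.Nonempty) : ∃ m ∈ u, ∀ p ∈ u, p <+: m := by
  obtain ⟨m, hm, hmax⟩ := u.exists_max_image List.length hne
  refine ⟨m, hm, fun p hp => ?_⟩
  rcases hS.1 p (hu p hp) m (hu m hm) with h | h
  · exact h
  · rw [h.eq_of_length_le (hmax p hp)]

theorem sum_le_segSum {x : DyadicNode → ℝ} (hpos : ∀ a, 0 ≤ x a) {S : Set DyadicNode}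
    (h : SummOn x S) (u : Finset DyadicNode) (hu : ∀ p ∈ u, p ∈ S) :
    ∑ p ∈ u, x p ≤ segSum x S := by
  rw [segSum_eq]
  calc ∑ p ∈ u, x p = ∑ p ∈ u, S.indicator x p :=
        Finset.sum_congr rfl (fun p hp => (Set.indicator_of_mem (hu p hp) x).symm)
    _ ≤ _ := h.sum_le_tsum u (fun n _ => Set.indicator_nonneg (fun a _ => hpos a) n)

theorem summOn_seg {x : DyadicNode → ℝ} (hb : HasBddNorm x) (hpos : ∀ a, 0 ≤ x a)
    {S : Set DyadicNode} (hS : IsSegment S) : SummOn x S := by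
  classical
  refine summable_of_sum_le (c := JTnormSq x + 1)
    (fun n => Set.indicator_nonneg (fun a _ => hpos a) n) ?_
  intro u
  have h1 : ∑ p ∈ u, S.indicator x p = ∑ p ∈ u.filter (· ∈ S), x p := by
    rw [Finset.sum_filter]
    exact Finset.sum_congr rfl (fun p _ => by simp [Set.indicator_apply])
  rw [h1]
  rcases (u.filter (· ∈ S)).eq_empty_or_nonempty with h | h
  · rw [h, Finset.sum_empty]
    have := segSum_sq_le hb (ivl_seg [] [])
    nlinarith [sq_nonneg (segSum x (ivl [] []))]
  · obtain ⟨m, -, hm⟩ := exists_top hS (u.filter (· ∈ S)) (fun p hp => (Finset.mem_filter.1 hp).2) h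
    refine (sum_le_segSum hpos (summOn_finite x (ivl_finite [] m)) _ ?_).trans
      (segSum_le hb (ivl_seg [] m))
    intro p hp
    exact ⟨List.nil_prefix, hm p hp⟩

theorem le_maxSum {x : DyadicNode → ℝ} (hb : HasBddNorm x) {c : DyadicNode}
    {s : Set DyadicNode} (hs : IsSegment s) (hc : c ∈ s) (hmin : ∀ b ∈ s, c <+: b) :
    segSum x s ≤ maxSum x c := by
  refine le_csSup ⟨JTnormSq x + 1, ?_⟩ ⟨s, hs, hc, hmin, rfl⟩
  rintro r ⟨s, hs, -, -, rfl⟩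
  exact segSum_le hb hs

theorem maxSum_nonneg {x : DyadicNode → ℝ} (hb : HasBddNorm x) (hpos : ∀ a, 0 ≤ x a)
    (c : DyadicNode) : 0 ≤ maxSum x c :=
  (segSum_nonneg hpos _).trans (le_maxSum hb (ivl_seg c c)
    ⟨List.prefix_rfl, List.prefix_rfl⟩ (fun _ h => h.1))

theorem exists_ivl {x : DyadicNode → ℝ} (hb : HasBddNorm x) (hpos : ∀ a, 0 ≤ x a)
    (c : DyadicNode) {ε : ℝ} (hε : 0 < ε) :
    ∃ m, c <+: m ∧ maxSum x c < segSum x (ivl c m) + ε := by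
  classical
  have hne : {r | ∃ s : Set DyadicNode, IsSegment s ∧ c ∈ s ∧ (∀ b ∈ s, c <+: b) ∧
      r = segSum x s}.Nonempty :=
    ⟨_, ivl c c, ivl_seg c c, ⟨List.prefix_rfl, List.prefix_rfl⟩, fun _ h => h.1, rfl⟩
  obtain ⟨r, ⟨s, hs, hc, hmin, rfl⟩, hr⟩ := exists_lt_of_lt_csSup hne
    (show maxSum x c - ε < sSup _ from sub_lt_self _ hε)
  have hsum := summOn_seg hb hpos hs
  rw [segSum_eq] at hr
  obtain ⟨u, hu⟩ := ((tendsto_order.1 hsum.hasSum).1 _ hr).exists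
  set v := insert c (u.filter (· ∈ s)) with hv
  have hvs : ∀ p ∈ v, p ∈ s := by
    intro p hp
    rcases Finset.mem_insert.1 hp with rfl | hp
    · exact hc
    · exact (Finset.mem_filter.1 hp).2
  obtain ⟨m, hmv, hm⟩ := exists_top hs v hvs ⟨c, Finset.mem_insert_self _ _⟩
  refine ⟨m, hmin m (hvs m hmv), ?_⟩
  have h1 : ∑ p ∈ u, s.indicator x p = ∑ p ∈ u.filter (· ∈ s), x p := by
    rw [Finset.sum_filter]
    exact Finset.sum_congr rfl (fun p _ => by simp [Set.indicator_apply])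
  have h2 : ∑ p ∈ u.filter (· ∈ s), x p ≤ segSum x (ivl c m) := by
    apply sum_le_segSum hpos (summOn_finite x (ivl_finite c m))
    intro p hp
    have hpv : p ∈ v := Finset.mem_insert_of_mem hp
    exact ⟨hmin p (hvs p hpv), hm p hpv⟩
  rw [h1] at hu
  linarith

theorem exists_supp {x : DyadicNode → ℝ} (hb : HasBddNorm x) (hpos : ∀ a, 0 ≤ x a)
    {c : DyadicNode} (h : 0 < maxSum x c) :
    (wedge c ∩ Function.support x).Nonempty := by
  obtain ⟨m, hm, hlt⟩ := exists_ivl hb hpos c h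
  by_contra hcon
  rw [Set.not_nonempty_iff_eq_empty] at hcon
  have : segSum x (ivl c m) = 0 := by
    unfold segSum
    have : ∀ p : ivl c m, x p = 0 := by
      intro p
      by_contra hp
      have : (p : DyadicNode) ∈ wedge c ∩ Function.support x := ⟨p.2.1, hp⟩
      rw [hcon] at this
      exact this
    simp [this]
  linarith

theorem maxSum_pos {x : DyadicNode → ℝ} (hb : HasBddNorm x) (hpos : ∀ a, 0 ≤ x a)
    {c w : DyadicNode} (hw : c <+: w) (hx : x w ≠ 0) : 0 < maxSum x c := by
  have h1 := le_maxSum (x := x) hb (ivl_seg c w) ⟨List.prefix_rfl, hw⟩ (fun _ h => h.1)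
  have h2 := segSum_mono hpos (summOn_finite x (ivl_finite c w)) (S := {w})
    (by rintro _ rfl; exact ⟨hw, List.prefix_rfl⟩)
  rw [segSum_singleton] at h2
  have := lt_of_le_of_ne (hpos w) (Ne.symm hx)
  linarith

theorem exists_finset {x : DyadicNode → ℝ} (hb : HasBddNorm x)
    {P : Set (Set DyadicNode)} (hP : IsNormingPartition x P) {S : Set DyadicNode} (hS : S ∈ P)
    {ε : ℝ} (hε : 0 < ε) :
    ∃ F : Finset (Set DyadicNode), S ∈ F ∧ (∀ U ∈ F, U ∈ P) ∧
      JTnormSq x - ε < ∑ U ∈ F, (segSum x U) ^ 2 := by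
  classical
  have hfin : ∀ F : Finset P, ∑ U ∈ F, (segSum x U) ^ 2 ≤ JTnormSq x := by
    intro F
    refine family_le hb F (fun U : P => (U : Set DyadicNode)) (fun U _ => hP.1.1 U U.2) ?_
    intro U _ V _ hne
    exact hP.1.2 U.2 V.2 (fun h => hne (Subtype.ext h))
  have hsum : Summable (fun U : P => (segSum x U) ^ 2) :=
    summable_of_sum_le (fun U => sq_nonneg _) hfin
  have hlt : JTnormSq x - ε < ∑' U : P, (segSum x U) ^ 2 := by
    have := hP.2
    unfold pNormSq at this
    linarith
  obtain ⟨F, hF⟩ := ((tendsto_order.1 hsum.hasSum).1 _ hlt).exists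
  refine ⟨(insert ⟨S, hS⟩ F).map (Function.Embedding.subtype _), ?_, ?_, ?_⟩
  · simp [hS]
  · intro U hU
    rw [Finset.mem_map] at hU
    obtain ⟨V, -, rfl⟩ := hU
    exact V.2
  · rw [Finset.sum_map]
    exact hF.trans_le (Finset.sum_le_sum_of_subset_of_nonneg (Finset.subset_insert _ _)
      (fun _ _ _ => sq_nonneg _))

/-- The top part of an interval. -/
def tl (c m : DyadicNode) (i : ℕ) : Set DyadicNode := {p ∈ ivl c m | p.length < c.length + i}

theorem tl_zero (c m : DyadicNode) : tl c m 0 = ∅ := by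
  ext p
  simp only [tl, Set.mem_setOf_eq, Set.mem_empty_iff_false, iff_false, not_and]
  intro hp
  have := hp.1.length_le
  omega

theorem tl_full (c m : DyadicNode) : tl c m (m.length + 1 - c.length) = ivl c m := by
  ext p
  simp only [tl, Set.mem_setOf_eq, and_iff_left_iff_imp]
  intro hp
  have := hp.1.length_le
  have := hp.2.length_le
  omega

/-- The `i`-th node of the interval. -/
def nd (c m : DyadicNode) (i : ℕ) : DyadicNode := m.take (c.length + i)

theorem nd_len {c m : DyadicNode} {i : ℕ} (hi : i < m.length + 1 - c.length) :
    (nd c m i).length = c.length + i := by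
  simp only [nd, List.length_take]
  omega

theorem nd_mem {c m : DyadicNode} (hc : c <+: m) {i : ℕ} (hi : i < m.length + 1 - c.length) :
    nd c m i ∈ ivl c m := by
  have h : nd c m i <+: m := List.take_prefix _ _
  refine ⟨List.prefix_of_prefix_length_le hc h ?_, h⟩
  rw [nd_len hi]; omega

theorem tl_succ {c m : DyadicNode} (hc : c <+: m) {i : ℕ} (hi : i < m.length + 1 - c.length) :
    tl c m (i + 1) = tl c m i ∪ {nd c m i} := by
  ext p
  simp only [tl, Set.mem_setOf_eq, Set.mem_union, Set.mem_singleton_iff]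
  constructor
  · rintro ⟨hp, hl⟩
    by_cases h : p.length < c.length + i
    · exact Or.inl ⟨hp, h⟩
    · right
      have hl' := nd_len hi
      exact (List.prefix_of_prefix_length_le hp.2 (nd_mem hc hi).2 (by omega)).eq_of_length
        (by omega)
  · rintro (⟨hp, hl⟩ | rfl)
    · exact ⟨hp, by omega⟩
    · exact ⟨nd_mem hc hi, by rw [nd_len hi]; omega⟩

theorem nd_not_tl {c m : DyadicNode} {i : ℕ} (hi : i < m.length + 1 - c.length) :
    nd c m i ∉ tl c m i := by
  intro h
  have := h.2
  rw [nd_len hi] at this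
  omega

theorem split_step {x : DyadicNode → ℝ} (hpos : ∀ a, 0 ≤ x a) {c m : DyadicNode} (hc : c <+: m)
    {i : ℕ} (hi : i < m.length + 1 - c.length) {U : Set DyadicNode} (hU : SummOn x U)
    (hm : nd c m i ∈ U) :
    segSum x (U \ tl c m i) = x (nd c m i) + segSum x (U \ tl c m (i + 1)) := by
  rw [← segSum_singleton x (nd c m i), ← segSum_union]
  · congr 1
    ext p
    rw [tl_succ hc hi]
    simp only [Set.mem_diff, Set.mem_union, Set.mem_singleton_iff]
    have := nd_not_tl hi
    constructor
    · rintro ⟨h1, h2⟩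
      by_cases hp : p = nd c m i
      · exact Or.inl hp
      · exact Or.inr ⟨h1, by tauto⟩
    · rintro (rfl | ⟨h1, h2⟩)
      · exact ⟨hm, this⟩
      · exact ⟨h1, by tauto⟩
  · exact summOn_finite x (Set.finite_singleton _)
  · exact hU.mono hpos Set.diff_subset
  · rw [Set.disjoint_singleton_left, tl_succ hc hi]
    simp

theorem split_step' {c m : DyadicNode} (hc : c <+: m)
    {i : ℕ} (hi : i < m.length + 1 - c.length) {U : Set DyadicNode}
    (hm : nd c m i ∉ U) : U \ tl c m i = U \ tl c m (i + 1) := by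
  ext p
  rw [tl_succ hc hi]
  simp only [Set.mem_diff, Set.mem_union, Set.mem_singleton_iff]
  constructor
  · rintro ⟨h1, h2⟩
    refine ⟨h1, ?_⟩
    rintro (h | rfl)
    · exact h2 h
    · exact hm h1
  · rintro ⟨h1, h2⟩
    exact ⟨h1, by tauto⟩

/-- Comparison of tails, when the interval is nearly optimal. -/
theorem tail_le {x : DyadicNode → ℝ} (hb : HasBddNorm x) (hpos : ∀ a, 0 ≤ x a)
    {c m : DyadicNode} (hc : c <+: m) {ε : ℝ} (hε : maxSum x c < segSum x (ivl c m) + ε)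
    {i : ℕ} (hi : i < m.length + 1 - c.length) {U : Set DyadicNode} (hU : IsSegment U)
    (hUc : ∀ p ∈ U, c <+: p) (hm : nd c m i ∈ U) :
    segSum x (U \ tl c m i) ≤ segSum x (ivl c m \ tl c m i) + ε := by
  have htf : (tl c m i).Finite := (ivl_finite c m).subset (fun p hp => hp.1)
  have h1 : segSum x (ivl c m) = segSum x (tl c m i) + segSum x (ivl c m \ tl c m i) := by
    rw [← segSum_union (summOn_finite x htf)
      (summOn_finite x ((ivl_finite c m).subset Set.diff_subset)) Set.disjoint_sdiff_right]
    congr 1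
    exact (Set.union_diff_cancel (fun p hp => hp.1)).symm
  have h2 := segSum_union (summOn_finite x htf)
    ((summOn_seg hb hpos hU).mono hpos (Set.diff_subset (t := tl c m i)))
    Set.disjoint_sdiff_right
  have key : ∀ q ∈ U \ tl c m i, nd c m i <+: q := by
    rintro q ⟨hq, hqt⟩
    rcases hU.1 _ hm q hq with h | h
    · exact h
    · have hqi : q ∈ ivl c m := ⟨hUc q hq, h.trans (nd_mem hc hi).2⟩
      have : ¬ q.length < c.length + i := fun hh => hqt ⟨hqi, hh⟩
      rw [h.eq_of_length_le (by rw [nd_len hi]; omega)]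
  have key2 : ∀ p ∈ tl c m i, p <+: nd c m i := by
    intro p hp
    exact List.prefix_of_prefix_length_le hp.1.2 (nd_mem hc hi).2
      (by rw [nd_len hi]; exact hp.2.le)
  have hseg : IsSegment (tl c m i ∪ U \ tl c m i) := by
    constructor
    · rintro p (hp | hp) q (hq | hq)
      · exact (ivl_seg c m).1 p hp.1 q hq.1
      · exact Or.inl ((key2 p hp).trans (key q hq))
      · exact Or.inr ((key2 q hq).trans (key p hp))
      · exact hU.1 p hp.1 q hq.1
    · rintro p hp q hq r hpr hrq
      have hcp : c <+: p := by
        rcases hp with hp | hp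
        · exact hp.1.1
        · exact hUc p hp.1
      by_cases hrt : r ∈ tl c m i
      · exact Or.inl hrt
      right
      refine ⟨?_, hrt⟩
      rcases hq with hq | hq
      · exact absurd ⟨⟨hcp.trans hpr, hrq.trans hq.1.2⟩, hrq.length_le.trans_lt hq.2⟩ hrt
      rcases List.prefix_or_prefix_of_prefix hrq (key q hq) with h | h
      · have hri : r ∈ ivl c m := ⟨hcp.trans hpr, h.trans (nd_mem hc hi).2⟩
        have : ¬ r.length < c.length + i := fun hh => hrt ⟨hri, hh⟩
        rw [h.eq_of_length_le (by rw [nd_len hi]; omega)]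
        exact hm
      · exact hU.2 _ hm q hq.1 r h hrq
  have hmin : ∀ b ∈ tl c m i ∪ U \ tl c m i, c <+: b := by
    rintro b (hb | hb)
    · exact hb.1.1
    · exact hUc b hb.1
  have hcmem : c ∈ tl c m i ∪ U \ tl c m i := by
    by_cases h : c ∈ tl c m i
    · exact Or.inl h
    · right
      refine ⟨?_, h⟩
      have hci : c ∈ ivl c m := ⟨List.prefix_rfl, hc⟩
      have h3 : ¬ c.length < c.length + i := fun hh => h ⟨hci, hh⟩
      have h4 : c = nd c m i := (nd_mem hc hi).1.eq_of_length (by rw [nd_len hi]; omega)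
      rw [h4]
      rw [← h4]
      rw [← h4] at hm
      exact hm
  have h3 := le_maxSum hb hseg hcmem hmin
  rw [h2] at h3
  linarith

/-- Weight of the `i`-th node. -/
noncomputable def wt (x : DyadicNode → ℝ) (c m : DyadicNode) (ε : ℝ) (i : ℕ) : ℝ :=
  x (nd c m i) * (2 * segSum x (ivl c m \ tl c m i) - x (nd c m i) + 2 * ε)

theorem wt_nonneg {x : DyadicNode → ℝ} (hpos : ∀ a, 0 ≤ x a)
    {c m : DyadicNode} (hc : c <+: m) {ε : ℝ} (hε : 0 < ε) {i : ℕ}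
    (hi : i < m.length + 1 - c.length) : 0 ≤ wt x c m ε i := by
  have h := split_step hpos hc hi (summOn_finite x (ivl_finite c m)) (nd_mem hc hi)
  have := segSum_nonneg hpos (ivl c m \ tl c m (i + 1))
  have := hpos (nd c m i)
  apply mul_nonneg this
  linarith

theorem wt_sum {x : DyadicNode → ℝ} (hpos : ∀ a, 0 ≤ x a)
    {c m : DyadicNode} (hc : c <+: m) (ε : ℝ) :
    ∑ i ∈ Finset.range (m.length + 1 - c.length), wt x c m ε i =
      (segSum x (ivl c m)) ^ 2 + 2 * ε * segSum x (ivl c m) := by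
  have h : ∀ i ∈ Finset.range (m.length + 1 - c.length), wt x c m ε i =
      ((segSum x (ivl c m \ tl c m i)) ^ 2 + 2 * ε * segSum x (ivl c m \ tl c m i)) -
      ((segSum x (ivl c m \ tl c m (i + 1))) ^ 2
        + 2 * ε * segSum x (ivl c m \ tl c m (i + 1))) := by
    intro i hi
    rw [Finset.mem_range] at hi
    have h := split_step hpos hc hi (summOn_finite x (ivl_finite c m)) (nd_mem hc hi)
    unfold wt
    rw [h]
    ring
  rw [Finset.sum_congr rfl h, Finset.sum_range_sub'
    (fun i => (segSum x (ivl c m \ tl c m i)) ^ 2 + 2 * ε * segSum x (ivl c m \ tl c m i)),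
    tl_zero, tl_full, Set.diff_self, Set.diff_empty, segSum_empty]
  ring

open Classical in
theorem one_seg {x : DyadicNode → ℝ} (hb : HasBddNorm x) (hpos : ∀ a, 0 ≤ x a)
    {c m : DyadicNode} (hc : c <+: m) {ε : ℝ} (hε : maxSum x c < segSum x (ivl c m) + ε)
    {U : Set DyadicNode} (hU : IsSegment U)
    (hUc : ∀ p ∈ U, c <+: p → ∀ q ∈ U, c <+: q) :
    (segSum x U) ^ 2 ≤ (segSum x (U \ ivl c m)) ^ 2 +
      ∑ i ∈ Finset.range (m.length + 1 - c.length),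
        if nd c m i ∈ U then wt x c m ε i else 0 := by
  have h : ∀ i ∈ Finset.range (m.length + 1 - c.length),
      (segSum x (U \ tl c m i)) ^ 2 - (segSum x (U \ tl c m (i + 1))) ^ 2 ≤
        if nd c m i ∈ U then wt x c m ε i else 0 := by
    intro i hi
    rw [Finset.mem_range] at hi
    split_ifs with hm
    · have h1 := split_step hpos hc hi (summOn_seg hb hpos hU) hm
      have h2 := tail_le hb hpos hc hε hi hU (hUc _ hm (nd_mem hc hi).1) hm
      have h3 := hpos (nd c m i)
      have h4 : segSum x (U \ tl c m (i + 1)) = segSum x (U \ tl c m i) - x (nd c m i) := by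
        linarith
      rw [h4]
      unfold wt
      nlinarith [mul_le_mul_of_nonneg_left h2 h3]
    · rw [split_step' hc hi hm]
      simp
  have h' := Finset.sum_le_sum h
  rw [Finset.sum_range_sub' (fun i => (segSum x (U \ tl c m i)) ^ 2), tl_zero, tl_full,
    Set.diff_empty] at h'
  linarith

theorem child_ne {a p : DyadicNode} {i j : Bool} (hij : i ≠ j) (h1 : a ++ [i] <+: p)
    (h2 : a ++ [j] <+: p) : False := by
  have h := (List.prefix_of_prefix_length_le h1 h2 (by simp)).eq_of_length (by simp)
  simp at h
  exact hij h

theorem child_of {a p : DyadicNode} (h : a <+: p) (hne : p ≠ a) {i j : Bool} (hij : i ≠ j) :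
    a ++ [i] <+: p ∨ a ++ [j] <+: p := by
  obtain ⟨t, rfl⟩ := h
  cases t with
  | nil => simp at hne
  | cons b t =>
    have : b = i ∨ b = j := by
      revert hij; cases b <;> cases i <;> cases j <;> simp
    rcases this with rfl | rfl
    · left; exact ⟨t, by simp⟩
    · right; exact ⟨t, by simp⟩

theorem below_child {a p : DyadicNode} {i : Bool} (h : p <+: a ++ [i]) :
    p <+: a ∨ p = a ++ [i] := by
  rcases List.prefix_concat_iff.1 h with h | h
  · exact Or.inr h
  · exact Or.inl h

theorem core {x : DyadicNode → ℝ} (hb : HasBddNorm x) (hpos : ∀ a, 0 ≤ x a)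
    {a : DyadicNode} {i j : Bool} (hij : i ≠ j)
    {P : Set (Set DyadicNode)} (hP : IsNormingPartition x P) {S : Set DyadicNode} (hS : S ∈ P)
    (haS : a ∈ S) (hcS : a ++ [i] ∉ S) {ε : ℝ} (hε0 : 0 < ε) {m : DyadicNode}
    (hm : a ++ [i] <+: m) (hε : maxSum x (a ++ [i]) < segSum x (ivl (a ++ [i]) m) + ε) :
    2 * segSum x {p ∈ S | p <+: a} * (segSum x (ivl (a ++ [i]) m) - maxSum x (a ++ [j])) ≤
      2 * ε * segSum x (ivl (a ++ [i]) m) + ε := by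
  classical
  obtain ⟨F, hSF, hFP, hF⟩ := exists_finset hb hP hS hε0
  set c := a ++ [i] with hc
  set d := a ++ [j] with hd
  set t := ivl c m with ht
  set A : Set DyadicNode := {p ∈ S | p <+: a} with hA
  set B : Set DyadicNode := {p ∈ S | d <+: p} with hB
  have hac : a <+: c := List.prefix_append _ _
  have had : a <+: d := List.prefix_append _ _
  have hlen : c.length = a.length + 1 := by simp [hc]
  have hlend : d.length = a.length + 1 := by simp [hd]
  have hSseg := hP.1.1 S hS
  have hScp : ∀ p ∈ S, ¬ c <+: p := fun p hp h => hcS (hSseg.2 a haS p hp c hac h)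
  have hdisj : ∀ U ∈ P, ∀ V ∈ P, U ≠ V → Disjoint U V := fun U hU V hV h => hP.1.2 hU hV h
  have hSAB : S = A ∪ B := by
    ext p
    constructor
    · intro hp
      by_cases hpa : p = a
      · left; exact ⟨hp, hpa ▸ List.prefix_rfl⟩
      rcases hSseg.1 p hp a haS with h | h
      · exact Or.inl ⟨hp, h⟩
      · rcases child_of h hpa hij with h | h
        · exact absurd h (hScp p hp)
        · exact Or.inr ⟨hp, h⟩
    · rintro (h | h) <;> exact h.1
  have hAB : Disjoint A B := by
    rw [Set.disjoint_left]
    intro p hp hq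
    have := hp.2.length_le
    have := hq.2.length_le
    omega
  have hSsum := summOn_seg hb hpos hSseg
  have hAsum : SummOn x A := hSsum.mono hpos (fun p hp => hp.1)
  have hBsum : SummOn x B := hSsum.mono hpos (fun p hp => hp.1)
  have hsS : segSum x S = segSum x A + segSum x B := by
    rw [hSAB]; exact segSum_union hAsum hBsum hAB
  have hBseg : IsSegment B :=
    ⟨fun p hp q hq => hSseg.1 p hp.1 q hq.1,
     fun p hp q hq r h1 h2 => ⟨hSseg.2 p hp.1 q hq.1 r h1 h2, hp.2.trans h1⟩⟩
  have hBle : segSum x B ≤ maxSum x d := by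
    rcases B.eq_empty_or_nonempty with h | ⟨p, hp⟩
    · rw [h, segSum_empty]; exact maxSum_nonneg hb hpos d
    · exact le_maxSum hb hBseg ⟨hSseg.2 a haS p hp.1 d had hp.2, List.prefix_rfl⟩
        (fun q hq => hq.2)
  have hAt : Disjoint A t := by
    rw [Set.disjoint_left]
    intro p hp hq
    exact hScp p hp.1 hq.1
  have hAtseg : IsSegment (A ∪ t) := by
    constructor
    · rintro p (hp | hp) q (hq | hq)
      · exact hSseg.1 p hp.1 q hq.1
      · exact Or.inl (hp.2.trans (hac.trans hq.1))
      · exact Or.inr (hq.2.trans (hac.trans hp.1))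
      · exact (ivl_seg c m).1 p hp q hq
    · rintro p (hp | hp) q (hq | hq) r hpr hrq
      · exact Or.inl ⟨hSseg.2 p hp.1 q hq.1 r hpr hrq, hrq.trans hq.2⟩
      · rcases List.prefix_or_prefix_of_prefix hrq hq.1 with h | h
        · rcases below_child h with h | h
          · exact Or.inl ⟨hSseg.2 p hp.1 a haS r hpr h, h⟩
          · right; rw [h]; exact ⟨List.prefix_rfl, hm⟩
        · exact Or.inr ⟨h, hrq.trans hq.2⟩
      · exact absurd (hp.1.trans (hpr.trans hrq)) (hScp q hq.1)
      · exact Or.inr ((ivl_seg c m).2 p hp q hq r hpr hrq)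
  have hUc : ∀ U ∈ P, U ≠ S → ∀ p ∈ U, c <+: p → ∀ q ∈ U, c <+: q := by
    intro U hU hne p hp hcp q hq
    have hUseg := hP.1.1 U hU
    rcases hUseg.1 p hp q hq with h | h
    · exact hcp.trans h
    · rcases List.prefix_or_prefix_of_prefix hcp h with h' | h'
      · exact h'
      · rcases below_child h' with h2 | h2
        · have haU : a ∈ U := hUseg.2 q hq p hp a h2 (hac.trans hcp)
          exact absurd haS (Set.disjoint_left.1 (hdisj U hU S hS hne) haU)
        · rw [h2]
  have hUt : ∀ U ∈ P, U ≠ S → IsSegment (U \ t) := by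
    intro U hU hne
    have hUseg := hP.1.1 U hU
    refine ⟨fun p hp q hq => hUseg.1 p hp.1 q hq.1, fun p hp q hq r h1 h2 => ?_⟩
    have hr := hUseg.2 p hp.1 q hq.1 r h1 h2
    refine ⟨hr, fun hrt => hp.2 ⟨?_, h1.trans hrt.2⟩⟩
    exact hUc U hU hne r hr hrt.1 p hp.1
  -- the new family
  let f : Option (Set DyadicNode) → Set DyadicNode := fun o =>
    match o with
    | none => B
    | some U => if U = S then A ∪ t else U \ t
  have hfS : f (some S) = A ∪ t := if_pos rfl
  have hfU : ∀ U, U ≠ S → f (some U) = U \ t := fun U hU => if_neg hU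
  have hBAt : Disjoint B (A ∪ t) := by
    rw [Set.disjoint_union_right]
    refine ⟨hAB.symm, ?_⟩
    rw [Set.disjoint_left]
    intro p hp hq
    exact hScp p hp.1 hq.1
  have hBU : ∀ U ∈ P, U ≠ S → Disjoint B (U \ t) := fun U hU hne =>
    Disjoint.mono (fun p hp => hp.1) Set.diff_subset (hdisj S hS U hU hne.symm)
  have hAU : ∀ U ∈ P, U ≠ S → Disjoint (A ∪ t) (U \ t) := by
    intro U hU hne
    rw [Set.disjoint_union_left]
    exact ⟨Disjoint.mono (fun p hp => hp.1) Set.diff_subset (hdisj S hS U hU hne.symm),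
      Set.disjoint_sdiff_right⟩
  have hfam := family_le hb (Finset.insertNone F) f (by
    rintro (_ | U) hU
    · exact hBseg
    · have hUP := hFP U (Finset.some_mem_insertNone.1 hU)
      by_cases h : U = S
      · rw [h, hfS]; exact hAtseg
      · rw [hfU U h]; exact hUt U hUP h) (by
    rintro (_ | U) hU (_ | V) hV hne
    · exact absurd rfl hne
    · have hVP := hFP V (Finset.some_mem_insertNone.1 hV)
      by_cases h : V = S
      · rw [h, hfS]; exact hBAt
      · rw [hfU V h]; exact hBU V hVP h
    · have hVP := hFP U (Finset.some_mem_insertNone.1 hU)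
      by_cases h : U = S
      · rw [h, hfS]; exact hBAt.symm
      · rw [hfU U h]; exact (hBU U hVP h).symm
    · have hUP := hFP U (Finset.some_mem_insertNone.1 hU)
      have hVP := hFP V (Finset.some_mem_insertNone.1 hV)
      have hUV : U ≠ V := fun h => hne (by rw [h])
      by_cases h : U = S
      · have hV' : V ≠ S := fun h' => hUV (h.trans h'.symm)
        rw [h, hfS, hfU V hV']; exact hAU V hVP hV'
      · by_cases h' : V = S
        · rw [h', hfS, hfU U h]; exact (hAU U hUP h).symm
        · rw [hfU U h, hfU V h']
          exact Disjoint.mono Set.diff_subset Set.diff_subset (hdisj U hUP V hVP hUV))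
  rw [Finset.sum_insertNone, ← Finset.add_sum_erase F _ hSF, hfS] at hfam
  rw [← Finset.add_sum_erase F _ hSF] at hF
  have hfn : f none = B := rfl
  rw [hfn, segSum_union hAsum (summOn_finite x (ivl_finite c m)) hAt] at hfam
  have hsum1 : ∑ U ∈ F.erase S, (segSum x (f (some U))) ^ 2 =
      ∑ U ∈ F.erase S, (segSum x (U \ t)) ^ 2 :=
    Finset.sum_congr rfl (fun U hU => by rw [hfU U (Finset.ne_of_mem_erase hU)])
  rw [hsum1] at hfam
  have hsum2 : ∑ U ∈ F.erase S, (segSum x U) ^ 2 ≤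
      ∑ U ∈ F.erase S, (segSum x (U \ t)) ^ 2 +
        ∑ U ∈ F.erase S, ∑ k ∈ Finset.range (m.length + 1 - c.length),
          (if nd c m k ∈ U then wt x c m ε k else 0) := by
    rw [← Finset.sum_add_distrib]
    apply Finset.sum_le_sum
    intro U hU
    have hne := Finset.ne_of_mem_erase hU
    have hUP := hFP U (Finset.mem_of_mem_erase hU)
    exact one_seg hb hpos hm hε (hP.1.1 U hUP) (hUc U hUP hne)
  have hsum3 : ∑ U ∈ F.erase S, ∑ k ∈ Finset.range (m.length + 1 - c.length),
      (if nd c m k ∈ U then wt x c m ε k else 0) ≤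
      ∑ k ∈ Finset.range (m.length + 1 - c.length), wt x c m ε k := by
    rw [Finset.sum_comm]
    apply Finset.sum_le_sum
    intro k hk
    have hw := wt_nonneg hpos hm hε0 (Finset.mem_range.1 hk)
    rw [← Finset.sum_filter, Finset.sum_const, nsmul_eq_mul]
    have hcard : ((F.erase S).filter (fun U => nd c m k ∈ U)).card ≤ 1 := by
      rw [Finset.card_le_one]
      intro U hU V hV
      rw [Finset.mem_filter] at hU hV
      by_contra hne
      exact Set.disjoint_left.1 (hdisj U (hFP U (Finset.mem_of_mem_erase hU.1)) V
        (hFP V (Finset.mem_of_mem_erase hV.1)) hne) hU.2 hV.2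
    have hcard' : (((F.erase S).filter (fun U => nd c m k ∈ U)).card : ℝ) ≤ 1 := by
      exact_mod_cast hcard
    nlinarith
  rw [wt_sum hpos hm ε] at hsum3
  rw [hsS] at hF
  have hA0 := segSum_nonneg hpos A
  nlinarith [mul_le_mul_of_nonneg_left hBle hA0]

theorem maxSum_le {x : DyadicNode → ℝ} (hb : HasBddNorm x) (hpos : ∀ a, 0 ≤ x a)
    (hsep : Separated x) {a : DyadicNode} (ha : a ∈ Function.support x) {i j : Bool}
    (hij : i ≠ j) : maxSum x (a ++ [i]) ≤ maxSum x (a ++ [j]) := by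
  rcases le_or_gt (maxSum x (a ++ [i])) 0 with h0 | h0
  · exact h0.trans (maxSum_nonneg hb hpos _)
  obtain ⟨b, hbw, hbs⟩ := exists_supp hb hpos h0
  have har : a ∈ ran x := fun K hK => hK.2 ha
  have hac : a <+: a ++ [i] := List.prefix_append _ _
  have hcr : a ++ [i] ∈ ran x := fun K hK => hK.1 a (hK.2 ha) b (hK.2 hbs) _ hac hbw
  obtain ⟨P, hP, S, hS, S', hS', hne, haS, hcS'⟩ := hsep a har _ hcr (by simp)
  have hcS : a ++ [i] ∉ S := fun h => Set.disjoint_left.1 (hP.1.2 hS hS' hne) h hcS'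
  have hA : 0 < segSum x {p ∈ S | p <+: a} := by
    have h1 := segSum_mono hpos (S := {a}) (S' := {p ∈ S | p <+: a})
      ((summOn_seg hb hpos (hP.1.1 S hS)).mono hpos (fun p hp => hp.1))
      (by rintro _ rfl; exact ⟨haS, List.prefix_rfl⟩)
    rw [segSum_singleton] at h1
    exact (lt_of_le_of_ne (hpos a) (Ne.symm ha)).trans_le h1
  set A := segSum x {p ∈ S | p <+: a}
  set M := maxSum x (a ++ [i])
  have key : ∀ ε > 0, 2 * A * (M - maxSum x (a ++ [j])) ≤ 0 + ε * (2 * M + 1 + 2 * A) := by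
    intro ε hε0
    obtain ⟨m, hm, hε⟩ := exists_ivl hb hpos (a ++ [i]) hε0
    have h1 := core hb hpos hij hP hS haS hcS hε0 hm hε
    have h2 : segSum x (ivl (a ++ [i]) m) ≤ M :=
      le_maxSum hb (ivl_seg _ m) ⟨List.prefix_rfl, hm⟩ (fun _ h => h.1)
    nlinarith [mul_le_mul_of_nonneg_left h2 hε0.le, mul_lt_mul_of_pos_left hε hA]
  have hK : 0 < 2 * M + 1 + 2 * A := by linarith
  have h2 : 2 * A * (M - maxSum x (a ++ [j])) ≤ 0 := by
    apply le_of_forall_pos_le_add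
    intro δ hδ
    have := key (δ / (2 * M + 1 + 2 * A)) (div_pos hδ hK)
    rwa [div_mul_cancel₀ _ hK.ne'] at this
  by_contra hcon
  push Not at hcon
  have : 0 < 2 * A * (M - maxSum x (a ++ [j])) := by
    apply mul_pos (by linarith)
    linarith
  linarith

/-- For a positive separated vector `x ∈ JT` and a node `a ∈ supp x`
which is not maximal in `supp x`, both wedges at the children `a⌢0`, `a⌢1` of `a` meet the
support, and `S_{a⌢0}(x) = S_{a⌢1}(x)`. -/
theorem local_equal_sums (x : DyadicNode → ℝ) (hx : MemJT x) (hpos : ∀ a, 0 ≤ x a)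
    (hsep : Separated x) (a : DyadicNode) (ha : a ∈ Function.support x)
    (hnotmax : ∃ w ∈ Function.support x, a <+: w ∧ a ≠ w) :
    (wedge (a ++ [false]) ∩ Function.support x).Nonempty ∧
    (wedge (a ++ [true]) ∩ Function.support x).Nonempty ∧
    maxSum x (a ++ [false]) = maxSum x (a ++ [true]) := by
  have hb := hx.1
  have heq : maxSum x (a ++ [false]) = maxSum x (a ++ [true]) :=
    le_antisymm (maxSum_le hb hpos hsep ha (by simp)) (maxSum_le hb hpos hsep ha (by simp))
  obtain ⟨w, hw, haw, hne⟩ := hnotmax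
  have hp : 0 < maxSum x (a ++ [false]) := by
    rcases child_of haw (Ne.symm hne) (show false ≠ true by simp) with h | h
    · exact maxSum_pos hb hpos h hw
    · rw [heq]; exact maxSum_pos hb hpos h hw
  exact ⟨exists_supp hb hpos hp, exists_supp hb hpos (heq ▸ hp), heq⟩


end JTSpace
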